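/- Let $N\ge3$ and let $\rho\in C^1([0,\infty))$ satisfy $\rho(0)=1$, condition $(\rho_0)$ with some exponent $\gamma>0$, and condition $(\rho_1)$. Let $a\le0$, $b>0$, $p\in(1,2^*]$ and $q=2_*$. Suppose $u$ is a nonnegative classical solution of problem $(\mathcal{P}_0)$ whose first- and second-order partial derivatives extend continuously to $\overline{\mathbb{R}^N_+}$, and assume $\int_{\mathbb{R}^N_+}\rho(x_N)|\nabla u|^2\,dx<\infty$, $u\in L^{p}(\mathbb{R}^N_+)$, $u(\cdot,0)\in L^{2_*}(\mathbb{R}^{N-1})$, and that the energy identity $\int_{\mathbb{R}^N_+}\rho(x_N)|\nabla u|^2\,dx=a\int_{\mathbb{R}^N_+}u^{p}\,dx+b\int_{\mathbb{R}^{N-1}}u(x',0)^{2_*}\,dx'$ holds. Then $u\equiv0$. -/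

import Mathlib

open MeasureTheory Filter
open scoped Topology ENNReal

noncomputable section

/-- The last coordinate of a point of `ℝ^N`. -/
def xN (N : ℕ) (hN : 0 < N) (x : EuclideanSpace ℝ (Fin N)) : ℝ :=
  x ⟨N - 1, Nat.sub_lt hN Nat.one_pos⟩

/-- The open upper half-space `ℝ^N₊`. -/
def Hplus (N : ℕ) (hN : 0 < N) : Set (EuclideanSpace ℝ (Fin N)) :=
  {x | 0 < xN N hN x}

/-- The point `(y, t) ∈ ℝ^N` with horizontal part `y ∈ ℝ^(N-1)` and last coordinate `t`. -/
def mkPt (N : ℕ) (y : EuclideanSpace ℝ (Fin (N - 1))) (t : ℝ) :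
    EuclideanSpace ℝ (Fin N) :=
  (WithLp.equiv 2 (Fin N → ℝ)).symm fun i => if h : (i : ℕ) < N - 1 then y ⟨(i : ℕ), h⟩ else t

/-- The boundary point `(y, 0)`. -/
def bPt (N : ℕ) (y : EuclideanSpace ℝ (Fin (N - 1))) : EuclideanSpace ℝ (Fin N) :=
  mkPt N y 0

/-- Partial derivative of `u` in the `i`-th coordinate direction. -/
def pd (N : ℕ) (u : EuclideanSpace ℝ (Fin N) → ℝ) (i : Fin N)
    (x : EuclideanSpace ℝ (Fin N)) : ℝ :=
  fderiv ℝ u x (EuclideanSpace.single i 1)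

/-- `div (w ∇u)` written as a sum of coordinate partial derivatives. -/
def divW (N : ℕ) (w u : EuclideanSpace ℝ (Fin N) → ℝ)
    (x : EuclideanSpace ℝ (Fin N)) : ℝ :=
  ∑ i, pd N (fun z => w z * pd N u i z) i x

/-- `u` is a (pointwise) solution of problem `(P₀)`:
`-div(ρ(x_N) ∇u) = a |u|^(p-2) u` in `ℝ^N₊` and
`-∂u/∂x_N = b |u|^(q-2) u` on `ℝ^(N-1)`. -/
def IsSolutionP0 (N : ℕ) (hN : 0 < N) (ρ : ℝ → ℝ) (a b p q : ℝ)
    (u : EuclideanSpace ℝ (Fin N) → ℝ) : Prop :=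
  (∀ x, 0 < xN N hN x →
    -divW N (fun z => ρ (xN N hN z)) u x = a * |u x| ^ (p - 2) * u x) ∧
  ∀ y : EuclideanSpace ℝ (Fin (N - 1)),
    -pd N u ⟨N - 1, Nat.sub_lt hN Nat.one_pos⟩ (bPt N y) =
      b * |u (bPt N y)| ^ (q - 2) * u (bPt N y)


lemma pd_contDiff {N : ℕ} {f : EuclideanSpace ℝ (Fin N) → ℝ} {i : Fin N} (hf : ContDiff ℝ 1 f) :
    Continuous (pd N f i) := by
  unfold pd
  exact (hf.continuous_fderiv one_ne_zero).clm_apply continuous_const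

lemma pd_hcs {N : ℕ} {f : EuclideanSpace ℝ (Fin N) → ℝ} {i : Fin N} (hf : HasCompactSupport f) :
    HasCompactSupport (pd N f i) := hf.fderiv_apply (𝕜 := ℝ) _

lemma snoc_eq (n : ℕ) (y : Fin n → ℝ) :
    WithLp.toLp 2 ((Fin.last n).insertNth (α := fun _ => ℝ) 0 y) =
      bPt (n+1) (WithLp.toLp 2 y : EuclideanSpace ℝ (Fin n)) := by
  ext i
  refine Fin.lastCases ?_ (fun j => ?_) i
  · simp [bPt, mkPt]
  · have h := Fin.insertNth_apply_succAbove (α := fun _ => ℝ) (Fin.last n) 0 y j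
    rw [Fin.succAbove_last] at h
    simp [bPt, mkPt]

lemma bPt_last (n : ℕ) (y : EuclideanSpace ℝ (Fin n)) : bPt (n+1) y (Fin.last n) = 0 := by
  simp [bPt, mkPt]

lemma bPt_castSucc (n : ℕ) (y : EuclideanSpace ℝ (Fin n)) (j : Fin n) :
    bPt (n+1) y (Fin.castSucc j) = y j := by
  simp [bPt, mkPt]

lemma div_thm (n : ℕ) (W : Fin (n+1) → EuclideanSpace ℝ (Fin (n+1)) → ℝ)
    (hW : ∀ i, ContDiff ℝ 1 (W i)) (hc : ∀ i, HasCompactSupport (W i)) :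
    ∫ x in {x : EuclideanSpace ℝ (Fin (n+1)) | 0 < x (Fin.last n)}, ∑ i, pd (n+1) (W i) i x
      = - ∫ y : EuclideanSpace ℝ (Fin n), W (Fin.last n) (bPt (n+1) y) := by
  classical
  obtain ⟨M, hM0, hM⟩ : ∃ M : ℝ, 0 < M ∧ ∀ i x, (∃ j, M ≤ |x j|) → W i x = 0 ∧ pd (n+1) (W i) i x = 0 := by
    have h1 : ∀ i, ∃ M : ℝ, ∀ x ∈ tsupport (W i), ‖x‖ ≤ M := fun i =>
      (hc i).isCompact.isBounded.exists_norm_le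
    choose M hM using h1
    refine ⟨∑ i, |M i| + 1, by positivity, fun i x ⟨j, hj⟩ => ?_⟩
    have hx : x ∉ tsupport (W i) := by
      intro hx
      have h2 := hM i x hx
      have h3 : |x j| ≤ ‖x‖ := by simpa using PiLp.norm_apply_le x j
      have h4 : |M i| ≤ ∑ i, |M i| :=
        Finset.single_le_sum (f := fun i => |M i|) (fun i _ => abs_nonneg _) (Finset.mem_univ i)
      have := le_abs_self (M i)
      linarith
    refine ⟨image_eq_zero_of_notMem_tsupport hx, ?_⟩
    unfold pd
    have : fderiv ℝ (W i) x = 0 := by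
      by_contra h
      exact hx (support_fderiv_subset ℝ h)
    simp [this]
  let a : Fin (n+1) → ℝ := fun i => if i = Fin.last n then 0 else -M
  let b : Fin (n+1) → ℝ := fun _ => M
  have hab : a ≤ b := by
    intro i; simp only [a, b]; split_ifs <;> linarith
  let L : (Fin (n+1) → ℝ) →L[ℝ] EuclideanSpace ℝ (Fin (n+1)) :=
    ((PiLp.continuousLinearEquiv 2 ℝ (fun _ : Fin (n+1) => ℝ)).symm : _ →L[ℝ] _)
  have hL : ∀ x, L x = WithLp.toLp 2 x := fun x => rfl
  have key := integral_divergence_of_hasFDerivAt_off_countable' (E := ℝ) a b hab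
    (fun i x => W i (L x)) (fun i x => (fderiv ℝ (W i) (L x)).comp L) ∅ Set.countable_empty
    (fun i => ((hW i).continuous.comp L.continuous).continuousOn)
    (fun x _ i => ((hW i).differentiable one_ne_zero (L x)).hasFDerivAt.comp x L.hasFDerivAt)
    (by
      apply Continuous.integrableOn_Icc
      refine continuous_finsetSum _ fun i _ => ?_
      exact ((((hW i).continuous_fderiv one_ne_zero).comp L.continuous).clm_comp
        continuous_const).clm_apply continuous_const)
  have hpd : ∀ x : Fin (n+1) → ℝ, (∑ i, ((fderiv ℝ (W i) (L x)).comp L) (Pi.single i 1))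
      = ∑ i, pd (n+1) (W i) i (WithLp.toLp 2 x) := by
    intro x
    refine Finset.sum_congr rfl fun i _ => ?_
    simp [pd, hL]
  simp only [hpd] at key
  have lhs : ∫ x in {x : EuclideanSpace ℝ (Fin (n+1)) | 0 < x (Fin.last n)}, ∑ i, pd (n+1) (W i) i x
      = ∫ x in Set.Icc a b, ∑ i, pd (n+1) (W i) i (WithLp.toLp 2 x) := by
    rw [← (PiLp.volume_preserving_toLp (Fin (n+1))).setIntegral_preimage_emb
      (MeasurableEquiv.toLp 2 _).measurableEmbedding]
    have hm : MeasurableSet {x : Fin (n+1) → ℝ | 0 < x (Fin.last n)} :=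
      measurableSet_lt measurable_const (measurable_pi_apply _)
    have e : (WithLp.toLp 2 ⁻¹' {x : EuclideanSpace ℝ (Fin (n+1)) | 0 < x (Fin.last n)}) =
      {x : Fin (n+1) → ℝ | 0 < x (Fin.last n)} := rfl
    rw [e, ← integral_indicator hm, ← integral_indicator measurableSet_Icc]
    apply integral_congr_ae
    have hne : ∀ᵐ x : Fin (n+1) → ℝ, x (Fin.last n) ≠ 0 :=
      Measure.ae_eval_ne (fun _ => volume) (Fin.last n) 0
    filter_upwards [hne] with x hx
    simp only [Set.indicator_apply, Set.mem_ofPred_eq]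
    by_cases h2 : x ∈ Set.Icc a b
    · have : 0 < x (Fin.last n) := by
        have := h2.1 (Fin.last n)
        simp only [a, if_true] at this
        exact lt_of_le_of_ne this (Ne.symm hx)
      simp [h2, this]
    · rw [if_neg h2]
      split_ifs with h1
      · refine Finset.sum_eq_zero fun i _ => (hM i _ ?_).2
        by_contra! h3
        apply h2
        refine ⟨fun j => ?_, fun j => ?_⟩
        · have := (abs_lt.1 (h3 j)).1
          simp only [a]; split_ifs with hj
          · subst hj; exact h1.le
          · exact this.le
        · exact (abs_lt.1 (h3 j)).2.le
      · rfl
  rw [lhs, key, Fin.sum_univ_castSucc]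
  have hz : ∀ i : Fin (n+1), ∀ c y, M ≤ |c| → W i (L (i.insertNth (α := fun _ => ℝ) c y)) = 0 := by
    intro i c y hcM
    refine (hM i _ ⟨i, ?_⟩).1
    simpa [hL] using hcM
  rw [Finset.sum_eq_zero, zero_add]
  · simp only [hz (Fin.last n) (b _) _ (le_abs_self M), integral_zero, zero_sub]
    congr 1
    rw [← (PiLp.volume_preserving_toLp (Fin n)).integral_comp
      (MeasurableEquiv.toLp 2 _).measurableEmbedding]
    rw [← integral_indicator measurableSet_Icc]
    congr 1
    ext y
    have ha : a (Fin.last n) = 0 := by simp [a]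
    rw [ha]
    simp only [Set.indicator_apply, hL, snoc_eq]
    split_ifs with h
    · rfl
    · symm
      refine (hM _ _ ?_).1
      by_contra! h3
      apply h
      have h4 : ∀ j, |y j| < M := fun j => by
        have := h3 (Fin.castSucc j); rwa [bPt_castSucc] at this
      refine ⟨fun j => ?_, fun j => (abs_lt.1 (h4 j)).2.le⟩
      have := (abs_lt.1 (h4 j)).1.le
      simpa [a] using this
  · intro i _
    have : a i.castSucc = -M := by simp [a]
    rw [this]
    simp only [hz i.castSucc (b _) _ (le_abs_self M), hz i.castSucc (-M) _ (by rw [abs_neg]; exact le_abs_self M)]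
    simp

lemma pd_mul' {N : ℕ} {f g : EuclideanSpace ℝ (Fin N) → ℝ} {i : Fin N} {x}
    (hf : DifferentiableAt ℝ f x) (hg : DifferentiableAt ℝ g x) :
    pd N (fun z => f z * g z) i x = pd N f i x * g x + f x * pd N g i x := by
  unfold pd
  rw [fderiv_fun_mul hf hg]
  simp; ring

lemma pd_add' {N : ℕ} {f g : EuclideanSpace ℝ (Fin N) → ℝ} {i : Fin N} {x}
    (hf : DifferentiableAt ℝ f x) (hg : DifferentiableAt ℝ g x) :
    pd N (fun z => f z + g z) i x = pd N f i x + pd N g i x := by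
  unfold pd
  rw [fderiv_fun_add hf hg]
  simp

lemma pd_sub' {N : ℕ} {f g : EuclideanSpace ℝ (Fin N) → ℝ} {i : Fin N} {x}
    (hf : DifferentiableAt ℝ f x) (hg : DifferentiableAt ℝ g x) :
    pd N (fun z => f z - g z) i x = pd N f i x - pd N g i x := by
  unfold pd
  rw [fderiv_fun_sub hf hg]
  simp

lemma pd_sum' {N : ℕ} {ι : Type*} {s : Finset ι} {f : ι → EuclideanSpace ℝ (Fin N) → ℝ} {i : Fin N} {x}
    (hf : ∀ j, DifferentiableAt ℝ (f j) x) :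
    pd N (fun z => ∑ j ∈ s, f j z) i x = ∑ j ∈ s, pd N (f j) i x := by
  unfold pd
  rw [fderiv_fun_sum (fun j _ => hf j)]
  simp

lemma coord_contDiff {N : ℕ} (j : Fin N) {k : WithTop ℕ∞} :
    ContDiff ℝ k (fun x : EuclideanSpace ℝ (Fin N) => x j) :=
  ((EuclideanSpace.proj j : EuclideanSpace ℝ (Fin N) →L[ℝ] ℝ)).contDiff

lemma pd_coord {N : ℕ} (i j : Fin N) (x) :
    pd N (fun x : EuclideanSpace ℝ (Fin N) => x j) i x = if j = i then 1 else 0 := by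
  unfold pd
  have : fderiv ℝ (fun x : EuclideanSpace ℝ (Fin N) => x j) x = (EuclideanSpace.proj j : EuclideanSpace ℝ (Fin N) →L[ℝ] ℝ) :=
    ((EuclideanSpace.proj j : EuclideanSpace ℝ (Fin N) →L[ℝ] ℝ)).fderiv
  rw [this]
  simp

lemma pd_comp {N : ℕ} {h : ℝ → ℝ} {h' : ℝ} {f : EuclideanSpace ℝ (Fin N) → ℝ} {i : Fin N} {x}
    (hh : HasDerivAt h h' (f x)) (hf : DifferentiableAt ℝ f x) :
    pd N (fun z => h (f z)) i x = h' * pd N f i x := by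
  unfold pd
  have := (hh.comp_hasFDerivAt x hf.hasFDerivAt).fderiv
  rw [show (fun z => h (f z)) = h ∘ f from rfl, this]
  simp

lemma pd_contDiff_one {N : ℕ} {f : EuclideanSpace ℝ (Fin N) → ℝ} {i : Fin N} (hf : ContDiff ℝ 2 f) :
    ContDiff ℝ 1 (pd N f i) := by
  unfold pd
  exact (hf.fderiv_right (m := 1) (by norm_num)).clm_apply contDiff_const

lemma pd_symm {N : ℕ} {f : EuclideanSpace ℝ (Fin N) → ℝ} (i j : Fin N) (hf : ContDiff ℝ 2 f) (x) :
    pd N (pd N f i) j x = pd N (pd N f j) i x := by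
  have hs : IsSymmSndFDerivAt ℝ f x := hf.contDiffAt.isSymmSndFDerivAt (by simp)
  have hd : DifferentiableAt ℝ (fderiv ℝ f) x :=
    (hf.fderiv_right (m := 1) (by norm_num)).differentiable one_ne_zero x
  have e : ∀ k l : Fin N, pd N (pd N f k) l x =
      fderiv ℝ (fderiv ℝ f) x (EuclideanSpace.single l 1) (EuclideanSpace.single k 1) := by
    intro k l
    unfold pd
    rw [fderiv_clm_apply hd (differentiableAt_const _)]
    simp
  rw [e, e]
  exact hs.eq _ _

/-- the Pohozaev vector field -/
def pohV (N : ℕ) (l : Fin N) (ρ : ℝ → ℝ) (u F : EuclideanSpace ℝ (Fin N) → ℝ) (i : Fin N)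
    (x : EuclideanSpace ℝ (Fin N)) : ℝ :=
  (∑ j, x j * pd N u j x) * (ρ (x l) * pd N u i x) +
    x i * (F x - ρ (x l) * (∑ j, pd N u j x * pd N u j x) * (1/2))

lemma pohV_contDiff {N : ℕ} {l : Fin N} {ρ : ℝ → ℝ} {u F : EuclideanSpace ℝ (Fin N) → ℝ}
    (hρ : ContDiff ℝ 1 ρ) (hu : ContDiff ℝ 2 u) (hF : ContDiff ℝ 1 F) (i : Fin N) :
    ContDiff ℝ 1 (pohV N l ρ u F i) := by
  have hU : ∀ j, ContDiff ℝ 1 (pd N u j) := fun j => pd_contDiff_one hu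
  have hx : ∀ j, ContDiff ℝ 1 (fun x : EuclideanSpace ℝ (Fin N) => x j) := fun j => coord_contDiff j
  have hr : ContDiff ℝ 1 (fun x : EuclideanSpace ℝ (Fin N) => ρ (x l)) := hρ.comp (hx l)
  unfold pohV
  exact ((ContDiff.sum fun j _ => (hx j).mul (hU j)).mul (hr.mul (hU i))).add
    ((hx i).mul (hF.sub ((hr.mul (ContDiff.sum fun j _ => (hU j).mul (hU j))).mul contDiff_const)))

lemma pohV_div {N : ℕ} {l : Fin N} {ρ : ℝ → ℝ} {u F : EuclideanSpace ℝ (Fin N) → ℝ}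
    (hρ : ContDiff ℝ 1 ρ) (hu : ContDiff ℝ 2 u) (hF : ContDiff ℝ 1 F)
    (f : ℝ) (x : EuclideanSpace ℝ (Fin N))
    (hFf : ∀ i, pd N F i x = f * pd N u i x)
    (heq : ∑ i, pd N (fun z => ρ (z l) * pd N u i z) i x = -f) :
    ∑ i, pd N (pohV N l ρ u F i) i x =
      (1 - (N:ℝ)/2) * (ρ (x l) * ∑ j, pd N u j x * pd N u j x)
      - (1/2) * (deriv ρ (x l) * x l * ∑ j, pd N u j x * pd N u j x) + N * F x := by
  have hU : ∀ j, DifferentiableAt ℝ (pd N u j) x := fun j =>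
    (pd_contDiff_one hu).differentiable one_ne_zero x
  have hx : ∀ j, DifferentiableAt ℝ (fun x : EuclideanSpace ℝ (Fin N) => x j) x :=
    fun j => (coord_contDiff j (k := 1)).differentiable one_ne_zero x
  have hr : DifferentiableAt ℝ (fun x : EuclideanSpace ℝ (Fin N) => ρ (x l)) x :=
    (hρ.differentiable one_ne_zero _).comp x (hx l)
  have hF' : DifferentiableAt ℝ F x := hF.differentiable one_ne_zero x
  have hm : DifferentiableAt ℝ (fun z => ∑ j, z j * pd N u j z) x :=
    DifferentiableAt.fun_sum fun j _ => (hx j).fun_mul (hU j)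
  have hg : DifferentiableAt ℝ (fun z => ∑ j, pd N u j z * pd N u j z) x :=
    DifferentiableAt.fun_sum fun j _ => (hU j).fun_mul (hU j)
  have hrho : ∀ i, pd N (fun z => ρ (z l)) i x = deriv ρ (x l) * if l = i then 1 else 0 := by
    intro i
    rw [pd_comp (hρ.differentiable one_ne_zero _).hasDerivAt (hx l), pd_coord]
  have hpm : ∀ i, pd N (fun z => ∑ j, z j * pd N u j z) i x =
      pd N u i x + ∑ j, x j * pd N (pd N u j) i x := by
    intro i
    rw [pd_sum' (fun j => (hx j).fun_mul (hU j))]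
    simp_rw [fun j => pd_mul' (i := i) (hx j) (hU j), pd_coord]
    rw [Finset.sum_add_distrib]
    simp
  have hpg : ∀ i, pd N (fun z => ∑ j, pd N u j z * pd N u j z) i x =
      2 * ∑ j, pd N u j x * pd N (pd N u j) i x := by
    intro i
    rw [pd_sum' (fun j => (hU j).fun_mul (hU j))]
    simp_rw [fun j => pd_mul' (i := i) (hU j) (hU j)]
    rw [Finset.mul_sum]
    exact Finset.sum_congr rfl fun j _ => by ring
  have hc : ∀ i, pd N (fun _ : EuclideanSpace ℝ (Fin N) => (1/2 : ℝ)) i x = 0 := by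
    intro i; simp [pd]
  have step : ∀ i, pd N (pohV N l ρ u F i) i x =
      (pd N u i x + ∑ j, x j * pd N (pd N u j) i x) * (ρ (x l) * pd N u i x)
      + (∑ j, x j * pd N u j x) * pd N (fun z => ρ (z l) * pd N u i z) i x
      + (F x - ρ (x l) * (∑ j, pd N u j x * pd N u j x) * (1/2))
      + x i * (f * pd N u i x - (deriv ρ (x l) * (if l = i then 1 else 0) * (∑ j, pd N u j x * pd N u j x)
          + ρ (x l) * (2 * ∑ j, pd N u j x * pd N (pd N u j) i x)) * (1/2)) := by
    intro i
    unfold pohV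
    rw [pd_add' (hm.fun_mul (hr.fun_mul (hU i)))
      ((hx i).fun_mul (hF'.fun_sub ((hr.fun_mul hg).fun_mul (differentiableAt_const _)))),
      pd_mul' hm (hr.fun_mul (hU i)),
      pd_mul' (hx i) (hF'.fun_sub ((hr.fun_mul hg).fun_mul (differentiableAt_const _))),
      pd_sub' hF' ((hr.fun_mul hg).fun_mul (differentiableAt_const _)),
      pd_mul' (hr.fun_mul hg) (differentiableAt_const _), pd_mul' hr hg, hpm, hpg, hFf, hrho, pd_coord, hc]
    simp only [if_true]
    ring
  simp_rw [step]
  set g := ∑ j, pd N u j x * pd N u j x with hgdef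
  set m := ∑ j, x j * pd N u j x with hmdef
  set r := ρ (x l)
  have e1 : ∑ i, ∑ j, x j * pd N (pd N u j) i x * pd N u i x
      = ∑ i, x i * ∑ j, pd N u j x * pd N (pd N u j) i x := by
    rw [Finset.sum_comm]
    refine Finset.sum_congr rfl fun i _ => ?_
    rw [Finset.mul_sum]
    refine Finset.sum_congr rfl fun j _ => ?_
    rw [pd_symm i j hu x]; ring
  have e2 : ∑ i, (pd N u i x + ∑ j, x j * pd N (pd N u j) i x) * (r * pd N u i x)
     = r * g + r * ∑ i, x i * ∑ j, pd N u j x * pd N (pd N u j) i x := by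
    rw [← e1, hgdef, Finset.mul_sum, Finset.mul_sum, ← Finset.sum_add_distrib]
    refine Finset.sum_congr rfl fun i _ => ?_
    rw [← Finset.sum_mul]; ring
  have e3 : ∑ i, x i * (f * pd N u i x - (deriv ρ (x l) * (if l = i then 1 else 0) * g
          + r * (2 * ∑ j, pd N u j x * pd N (pd N u j) i x)) * (1/2))
      = f * m - (1/2) * (deriv ρ (x l) * x l * g) - r * ∑ i, x i * ∑ j, pd N u j x * pd N (pd N u j) i x := by
    have : deriv ρ (x l) * x l * g = ∑ i, x i * (deriv ρ (x l) * (if l = i then 1 else 0) * g) := by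
      simp; ring
    rw [this, hmdef, Finset.mul_sum, Finset.mul_sum, Finset.mul_sum, ← Finset.sum_sub_distrib,
      ← Finset.sum_sub_distrib]
    refine Finset.sum_congr rfl fun i _ => ?_
    ring
  rw [Finset.sum_add_distrib, Finset.sum_add_distrib, Finset.sum_add_distrib, e2, e3,
    ← Finset.mul_sum, heq]
  simp
  ring

lemma boundary_ibp {n : ℕ} {φ G : EuclideanSpace ℝ (Fin n) → ℝ} (hφ : ContDiff ℝ 1 φ)
    (hc : HasCompactSupport φ) (hG : ContDiff ℝ 1 G) :
    ∫ y, φ y * ∑ i, y i * pd n G i y = - ∫ y, (n * φ y + ∑ i, y i * pd n φ i y) * G y := by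
  have hx : ∀ j, ContDiff ℝ 1 (fun x : EuclideanSpace ℝ (Fin n) => x j) := fun j => coord_contDiff j
  have hcy : ∀ i, HasCompactSupport (fun y : EuclideanSpace ℝ (Fin n) => φ y * y i) := fun i =>
    hc.mul_right
  have hdy : ∀ i, ContDiff ℝ 1 (fun y : EuclideanSpace ℝ (Fin n) => φ y * y i) := fun i => hφ.mul (hx i)
  have i1 : ∀ i, Integrable (fun y => pd n (fun y => φ y * y i) i y * G y) := fun i =>
    Continuous.integrable_of_hasCompactSupport ((pd_contDiff (hdy i)).mul hG.continuous)
      ((pd_hcs (hcy i)).mul_right)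
  have i2 : ∀ i, Integrable (fun y => (φ y * y i) * pd n G i y) := fun i =>
    Continuous.integrable_of_hasCompactSupport ((hdy i).continuous.mul (pd_contDiff hG))
      ((hcy i).mul_right)
  have i3 : ∀ i, Integrable (fun y => (φ y * y i) * G y) := fun i =>
    Continuous.integrable_of_hasCompactSupport ((hdy i).continuous.mul hG.continuous)
      ((hcy i).mul_right)
  have key : ∀ i, ∫ y, (φ y * y i) * pd n G i y = - ∫ y, pd n (fun y => φ y * y i) i y * G y :=
    fun i => integral_mul_fderiv_eq_neg_fderiv_mul_of_integrable (i1 i) (i2 i) (i3 i)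
      (fun x _ => (hdy i).differentiable one_ne_zero x) (fun x _ => hG.differentiable one_ne_zero x)
  have l : ∀ y, φ y * ∑ i, y i * pd n G i y = ∑ i, (φ y * y i) * pd n G i y := by
    intro y; rw [Finset.mul_sum]; exact Finset.sum_congr rfl fun i _ => by ring
  have r : ∀ y, (n * φ y + ∑ i, y i * pd n φ i y) * G y = ∑ i, pd n (fun y => φ y * y i) i y * G y := by
    intro y
    have : ∀ i, pd n (fun y => φ y * y i) i y = pd n φ i y * y i + φ y := by
      intro i
      rw [pd_mul' (hφ.differentiable one_ne_zero y) ((hx i).differentiable one_ne_zero y), pd_coord]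
      simp
    simp_rw [this]
    rw [← Finset.sum_mul, Finset.sum_add_distrib]
    simp
    left
    rw [add_comm]
    congr 1
    exact Finset.sum_congr rfl fun i _ => by ring
  simp_rw [l, r]
  rw [integral_finsetSum _ fun i _ => i2 i, integral_finsetSum _ fun i _ => i1 i,
    ← Finset.sum_neg_distrib]
  exact Finset.sum_congr rfl fun i _ => key i

/-- the radial profile of the cutoff -/
def chi (s : ℝ) : ℝ := Real.smoothTransition (2 - s)

lemma chi_contDiff : ContDiff ℝ 2 chi :=
  (Real.smoothTransition.contDiff (n := 2)).comp (contDiff_const.sub contDiff_id)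

lemma chi_one {s : ℝ} (h : s ≤ 1) : chi s = 1 := Real.smoothTransition.one_of_one_le (by linarith)
lemma chi_zero {s : ℝ} (h : 2 ≤ s) : chi s = 0 := Real.smoothTransition.zero_of_nonpos (by linarith)

lemma dchi_zero {s : ℝ} (h : s < 1) : deriv chi s = 0 := by
  have : chi =ᶠ[𝓝 s] fun _ => 1 := by
    filter_upwards [Iio_mem_nhds h] with t ht using chi_one (le_of_lt ht)
  rw [this.deriv_eq]; simp

lemma dchi_zero' {s : ℝ} (h : 2 < s) : deriv chi s = 0 := by
  have : chi =ᶠ[𝓝 s] fun _ => 0 := by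
    filter_upwards [Ioi_mem_nhds h] with t ht using chi_zero (le_of_lt ht)
  rw [this.deriv_eq]; simp

lemma chi_bound : ∃ K : ℝ, 0 ≤ K ∧ ∀ s : ℝ, 0 ≤ s → |2 * deriv chi s * s| ≤ K := by
  have hcont : Continuous fun s => |2 * deriv chi s * s| :=
    ((continuous_const.mul (chi_contDiff.continuous_deriv (by norm_num))).mul continuous_id).abs
  obtain ⟨K, hK⟩ := (isCompact_Icc (a := (0:ℝ)) (b := 2)).bddAbove_image hcont.continuousOn
  refine ⟨max K 0, le_max_right _ _, fun s hs => ?_⟩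
  by_cases h : s ≤ 2
  · exact le_max_of_le_left (hK ⟨s, ⟨hs, h⟩, rfl⟩)
  · rw [dchi_zero' (not_le.1 h)]; simp

/-- the cutoff at scale `k+1` -/
def cut (N k : ℕ) (x : EuclideanSpace ℝ (Fin N)) : ℝ := chi ((((k:ℝ) + 1)^2)⁻¹ * ‖x‖^2)
/-- coefficient of its gradient -/
def cutc (k : ℕ) (t : ℝ) : ℝ := 2 * deriv chi ((((k:ℝ) + 1)^2)⁻¹ * t^2) * (((k:ℝ) + 1)^2)⁻¹

lemma cut_contDiff (N k : ℕ) : ContDiff ℝ 1 (cut N k) :=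
  (chi_contDiff.of_le (by norm_num)).comp (contDiff_const.mul (contDiff_norm_sq ℝ))

lemma cut_nonneg (N k : ℕ) (x) : 0 ≤ cut N k x := Real.smoothTransition.nonneg _
lemma cut_le_one (N k : ℕ) (x) : cut N k x ≤ 1 := Real.smoothTransition.le_one _

lemma cut_hcs (N k : ℕ) : HasCompactSupport (cut N k) := by
  apply HasCompactSupport.of_support_subset_isCompact (isCompact_closedBall 0 (2 * ((k:ℝ)+1)))
  intro x hx
  rw [Function.mem_support] at hx
  by_contra h
  apply hx
  apply chi_zero
  simp only [Metric.mem_closedBall, dist_zero_right, not_le] at h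
  have hk : (0:ℝ) < (k:ℝ)+1 := by positivity
  rw [inv_mul_eq_div, le_div_iff₀ (by positivity)]
  nlinarith

lemma cut_pd (N k : ℕ) (i : Fin N) (x) : pd N (cut N k) i x = cutc k ‖x‖ * x i := by
  have h1 : DifferentiableAt ℝ (fun x : EuclideanSpace ℝ (Fin N) => (((k:ℝ) + 1)^2)⁻¹ * ‖x‖^2) x :=
    (contDiff_const.mul (contDiff_norm_sq ℝ) : ContDiff ℝ 1 _).differentiable one_ne_zero x
  have h2 := pd_comp (i := i) (f := fun x : EuclideanSpace ℝ (Fin N) => (((k:ℝ) + 1)^2)⁻¹ * ‖x‖^2)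
    ((chi_contDiff.differentiable (by norm_num)) _).hasDerivAt h1
  have h3 : pd N (fun x : EuclideanSpace ℝ (Fin N) => (((k:ℝ) + 1)^2)⁻¹ * ‖x‖^2) i x
     = (((k:ℝ) + 1)^2)⁻¹ * (2 * x i) := by
    unfold pd
    rw [fderiv_const_mul ((contDiff_norm_sq ℝ (n := 1)).differentiable one_ne_zero x)]
    have := ((hasFDerivAt_id x).norm_sq).fderiv
    simp only [id] at this
    rw [this]
    simp
    left
    simp [EuclideanSpace.inner_single_right]
  change pd N (fun x => chi ((((k:ℝ) + 1)^2)⁻¹ * ‖x‖^2)) i x = _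
  rw [h2, h3]
  unfold cutc
  ring

lemma cutc_zero {k : ℕ} {t : ℝ} (h0 : 0 ≤ t) (h : t < k + 1) : cutc k t = 0 := by
  unfold cutc
  have hk : (0:ℝ) < (k:ℝ)+1 := by positivity
  rw [dchi_zero]
  · simp
  · rw [inv_mul_eq_div, div_lt_iff₀ (by positivity)]
    nlinarith

lemma cut_one {N k : ℕ} {x} (h : ‖x‖ < k + 1) : cut N k x = 1 := by
  apply chi_one
  have hk : (0:ℝ) < (k:ℝ)+1 := by positivity
  have := norm_nonneg x
  rw [inv_mul_eq_div, div_le_iff₀ (by positivity)]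
  nlinarith

lemma cutc_bound : ∃ K : ℝ, 0 ≤ K ∧ ∀ (k : ℕ) (t : ℝ), |cutc k t| * t^2 ≤ K := by
  obtain ⟨K, h0, hK⟩ := chi_bound
  refine ⟨K, h0, fun k t => ?_⟩
  have := hK ((((k:ℝ) + 1)^2)⁻¹ * t^2) (by positivity)
  calc _ = |2 * deriv chi ((((k:ℝ) + 1)^2)⁻¹ * t^2) * ((((k:ℝ) + 1)^2)⁻¹ * t^2)| := by
        unfold cutc
        rw [← abs_of_nonneg (sq_nonneg t), ← abs_mul, abs_of_nonneg (sq_nonneg t)]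
        ring_nf
    _ ≤ K := this

lemma norm_bPt (n : ℕ) (y : EuclideanSpace ℝ (Fin n)) : ‖bPt (n+1) y‖ = ‖y‖ := by
  rw [EuclideanSpace.norm_eq, EuclideanSpace.norm_eq, Fin.sum_univ_castSucc]
  simp [bPt_last, bPt_castSucc]

/-- `bPt` as a continuous linear map -/
def bL (n : ℕ) : EuclideanSpace ℝ (Fin n) →L[ℝ] EuclideanSpace ℝ (Fin (n+1)) :=
  LinearMap.toContinuousLinearMap
    { toFun := bPt (n+1)
      map_add' := by
        intro x y; ext i
        refine Fin.lastCases ?_ (fun j => ?_) i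
        · simp [bPt_last]
        · simp [bPt_castSucc]
      map_smul' := by
        intro c y; ext i
        refine Fin.lastCases ?_ (fun j => ?_) i
        · simp [bPt_last]
        · simp [bPt_castSucc] }

lemma bL_apply (n : ℕ) (y) : bL n y = bPt (n+1) y := rfl

lemma bPt_contDiff (n : ℕ) {k : WithTop ℕ∞} : ContDiff ℝ k (fun y : EuclideanSpace ℝ (Fin n) => bPt (n+1) y) :=
  (bL n).contDiff

lemma bL_single (n : ℕ) (i : Fin n) :
    bL n (EuclideanSpace.single i 1) = EuclideanSpace.single (Fin.castSucc i) 1 := by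
  rw [bL_apply]
  ext j
  refine Fin.lastCases ?_ (fun j => ?_) j
  · rw [bPt_last]
    have : Fin.last n ≠ Fin.castSucc i := (Fin.castSucc_lt_last i).ne'
    simp
  · rw [bPt_castSucc]
    simp [Pi.single_apply]

lemma pd_bPt {n : ℕ} {u : EuclideanSpace ℝ (Fin (n+1)) → ℝ} (hu : ContDiff ℝ 2 u) (i : Fin n) (y) :
    pd n (fun y => u (bPt (n+1) y)) i y = pd (n+1) u (Fin.castSucc i) (bPt (n+1) y) := by
  unfold pd
  have h := ((hu.differentiable two_ne_zero (bL n y)).hasFDerivAt.comp y (bL n).hasFDerivAt).fderiv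
  have e : (fun y : EuclideanSpace ℝ (Fin n) => u (bPt (n+1) y)) = u ∘ (bL n) := rfl
  rw [e, h, ContinuousLinearMap.comp_apply, bL_single]
  rfl

lemma absrpow_contDiff {E : Type*} [NormedAddCommGroup E] [NormedSpace ℝ E] {u : E → ℝ} {p : ℝ} (hp : 1 < p)
    (hu : ContDiff ℝ 1 u) : ContDiff ℝ 1 (fun x => |u x| ^ p) := by
  simpa using hu.norm_rpow hp

lemma pd_absrpow {N : ℕ} {u : EuclideanSpace ℝ (Fin N) → ℝ} {p : ℝ} (hp : 1 < p) (c : ℝ)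
    (hu : ContDiff ℝ 1 u) (i x) :
    pd N (fun x => c / p * |u x| ^ p) i x = c * |u x| ^ (p-2) * u x * pd N u i x := by
  have h := pd_comp (i := i) ((hasDerivAt_abs_rpow (u x) hp).const_mul (c/p))
    (hu.differentiable one_ne_zero x)
  rw [h]
  have : p ≠ 0 := by linarith
  field_simp

lemma sum_sq_le {N : ℕ} (x : EuclideanSpace ℝ (Fin N)) (v : Fin N → ℝ) :
    (∑ j, x j * v j)^2 ≤ ‖x‖^2 * ∑ j, v j * v j := by
  have := Finset.sum_mul_sq_le_sq_mul_sq Finset.univ (fun j => x j) v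
  rw [EuclideanSpace.real_norm_sq_eq]
  simpa [sq] using this

lemma pohozaev {n : ℕ} {ρ : ℝ → ℝ} (hρ : ContDiff ℝ 1 ρ) (hρ0 : ρ 0 = 1)
    (hρpos : ∀ s : ℝ, 0 < s → 0 ≤ ρ s) {a b p q : ℝ} (hp : 1 < p) (hq : 1 < q)
    {u : EuclideanSpace ℝ (Fin (n+1)) → ℝ} (hu : ContDiff ℝ 2 u)
    (heq : ∀ x : EuclideanSpace ℝ (Fin (n+1)), 0 < x (Fin.last n) →
      ∑ i, pd (n+1) (fun z => ρ (z (Fin.last n)) * pd (n+1) u i z) i x = -(a * |u x| ^ (p-2) * u x))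
    (hbd : ∀ y : EuclideanSpace ℝ (Fin n), -pd (n+1) u (Fin.last n) (bPt (n+1) y)
      = b * |u (bPt (n+1) y)| ^ (q-2) * u (bPt (n+1) y))
    (he : IntegrableOn (fun x => ρ (x (Fin.last n)) * ∑ j, pd (n+1) u j x * pd (n+1) u j x)
      {x : EuclideanSpace ℝ (Fin (n+1)) | 0 < x (Fin.last n)})
    (he' : IntegrableOn (fun x => deriv ρ (x (Fin.last n)) * x (Fin.last n) *
        ∑ j, pd (n+1) u j x * pd (n+1) u j x)
      {x : EuclideanSpace ℝ (Fin (n+1)) | 0 < x (Fin.last n)})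
    (hLp : IntegrableOn (fun x => |u x| ^ p) {x : EuclideanSpace ℝ (Fin (n+1)) | 0 < x (Fin.last n)})
    (hLq : Integrable (fun y : EuclideanSpace ℝ (Fin n) => |u (bPt (n+1) y)| ^ q)) :
    (1 - ((n+1 : ℕ):ℝ)/2) * (∫ x in {x : EuclideanSpace ℝ (Fin (n+1)) | 0 < x (Fin.last n)},
        ρ (x (Fin.last n)) * ∑ j, pd (n+1) u j x * pd (n+1) u j x)
      - (1/2) * (∫ x in {x : EuclideanSpace ℝ (Fin (n+1)) | 0 < x (Fin.last n)},
        deriv ρ (x (Fin.last n)) * x (Fin.last n) * ∑ j, pd (n+1) u j x * pd (n+1) u j x)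
      + ((n+1 : ℕ):ℝ) * (a / p * ∫ x in {x : EuclideanSpace ℝ (Fin (n+1)) | 0 < x (Fin.last n)}, |u x| ^ p)
    = - (n * (b / q * ∫ y : EuclideanSpace ℝ (Fin n), |u (bPt (n+1) y)| ^ q)) := by
  set H : Set (EuclideanSpace ℝ (Fin (n+1))) := {x | 0 < x (Fin.last n)} with hH
  have hHm : MeasurableSet H :=
    (isOpen_lt continuous_const (coord_contDiff (Fin.last n) (k := 1)).continuous).measurableSet
  set l := Fin.last n with hl
  have hu1 : ContDiff ℝ 1 u := hu.of_le (by norm_num)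
  let F : EuclideanSpace ℝ (Fin (n+1)) → ℝ := fun x => a / p * |u x| ^ p
  have hF : ContDiff ℝ 1 F := contDiff_const.mul (absrpow_contDiff hp hu1)
  let G : EuclideanSpace ℝ (Fin n) → ℝ := fun y => b / q * |u (bPt (n+1) y)| ^ q
  have hub : ContDiff ℝ 1 (fun y : EuclideanSpace ℝ (Fin n) => u (bPt (n+1) y)) := hu1.comp (bPt_contDiff n)
  have hG : ContDiff ℝ 1 G := contDiff_const.mul (absrpow_contDiff hq hub)
  let g : EuclideanSpace ℝ (Fin (n+1)) → ℝ := fun x => ∑ j, pd (n+1) u j x * pd (n+1) u j x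
  let V := pohV (n+1) l ρ u F
  have hV : ∀ i, ContDiff ℝ 1 (V i) := fun i => pohV_contDiff hρ hu hF i
  let D : EuclideanSpace ℝ (Fin (n+1)) → ℝ := fun x =>
    (1 - ((n+1 : ℕ):ℝ)/2) * (ρ (x l) * g x) - (1/2) * (deriv ρ (x l) * x l * g x) + ((n+1 : ℕ):ℝ) * F x
  have hFi : IntegrableOn F H := hLp.const_mul _
  have hDi : IntegrableOn D H := ((he.const_mul _).sub (he'.const_mul _)).add (hFi.const_mul _)
  let Q : EuclideanSpace ℝ (Fin (n+1)) → ℝ := fun x => ∑ i, x i * V i x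
  obtain ⟨K, hK0, hK⟩ := cutc_bound
  have hQ : ∀ x, Q x = ρ (x l) * (∑ j, x j * pd (n+1) u j x)^2 + ‖x‖^2 * (F x - ρ (x l) * g x * (1/2)) := by
    intro x
    have e : ∀ i, x i * V i x = ρ (x l) * (∑ j, x j * pd (n+1) u j x) * (x i * pd (n+1) u i x)
        + x i ^ 2 * (F x - ρ (x l) * g x * (1/2)) := by
      intro i; simp only [V, pohV, g]; ring
    simp only [Q, e]
    rw [Finset.sum_add_distrib, ← Finset.mul_sum, ← Finset.sum_mul, EuclideanSpace.real_norm_sq_eq]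
    ring
  have hQb : ∀ x ∈ H, |Q x| ≤ ‖x‖^2 * (3/2 * (ρ (x l) * g x) + |F x|) := by
    intro x hx
    have hr := hρpos _ hx
    have hg : 0 ≤ g x := Finset.sum_nonneg fun j _ => mul_self_nonneg _
    have h1 := mul_le_mul_of_nonneg_left (sum_sq_le x (fun j => pd (n+1) u j x)) hr
    have h0 : 0 ≤ ρ (x l) * (∑ j, x j * pd (n+1) u j x)^2 := by positivity
    have h2 : 0 ≤ ‖x‖^2 := by positivity
    have h3 := mul_le_mul_of_nonneg_left (le_abs_self (F x)) h2
    have h4 := mul_le_mul_of_nonneg_left (neg_abs_le (F x)) h2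
    have h5 : 0 ≤ ‖x‖^2 * (ρ (x l) * g x) := by positivity
    have h6 : ρ (x l) * (∑ j, x j * pd (n+1) u j x)^2 ≤ ‖x‖^2 * (ρ (x l) * g x) := by
      refine h1.trans (le_of_eq ?_); simp only [g]; ring
    rw [hQ, abs_le]
    constructor <;> nlinarith
  -- the identity at scale `k`
  have main : ∀ k : ℕ, ∫ x in H, (cut (n+1) k x * D x + cutc k ‖x‖ * Q x) =
      - ∫ y : EuclideanSpace ℝ (Fin n), (n * cut n k y + cutc k ‖y‖ * ‖y‖^2) * G y := by
    intro k
    have hd := div_thm n (fun i x => cut (n+1) k x * V i x)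
      (fun i => (cut_contDiff _ k).mul (hV i)) (fun i => (cut_hcs _ k).mul_right)
    have e1 : ∫ x in H, ∑ i, pd (n+1) (fun x => cut (n+1) k x * V i x) i x
        = ∫ x in H, (cut (n+1) k x * D x + cutc k ‖x‖ * Q x) := by
      refine setIntegral_congr_fun hHm fun x hx => ?_
      have h1 := pohV_div (l := l) hρ hu hF (a * |u x| ^ (p-2) * u x) x
        (fun i => pd_absrpow hp a hu1 i x) (heq x hx)
      have h2 : ∀ i, pd (n+1) (fun x => cut (n+1) k x * V i x) i x =
          cutc k ‖x‖ * (x i * V i x) + cut (n+1) k x * pd (n+1) (V i) i x := by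
        intro i
        rw [pd_mul' ((cut_contDiff _ k).differentiable one_ne_zero x)
          ((hV i).differentiable one_ne_zero x), cut_pd]
        ring
      simp only [h2]
      rw [Finset.sum_add_distrib, ← Finset.mul_sum, ← Finset.mul_sum, h1, add_comm]
    rw [← e1, hd]
    congr 1
    have e2 : ∀ y : EuclideanSpace ℝ (Fin n), cut (n+1) k (bPt (n+1) y) * V l (bPt (n+1) y)
        = - (cut n k y * ∑ i, y i * pd n G i y) := by
      intro y
      have c1 : cut (n+1) k (bPt (n+1) y) = cut n k y := by simp only [cut, norm_bPt]
      have c2 : ∀ i, pd n G i y = b * |u (bPt (n+1) y)| ^ (q-2) * u (bPt (n+1) y) *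
          pd (n+1) u (Fin.castSucc i) (bPt (n+1) y) := by
        intro i
        rw [pd_absrpow hq b hub, pd_bPt hu]
      simp only [c2, ← hbd y, V, pohV]
      rw [c1, hl, bPt_last, hρ0, Fin.sum_univ_castSucc, bPt_last]
      simp only [bPt_castSucc]
      have : ∀ i : Fin n, y i * (-pd (n+1) u (Fin.last n) (bPt (n+1) y) * pd (n+1) u i.castSucc (bPt (n+1) y))
        = -pd (n+1) u (Fin.last n) (bPt (n+1) y) * (y i * pd (n+1) u i.castSucc (bPt (n+1) y)) := by
        intro i; ring
      simp only [this]
      rw [← Finset.mul_sum]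
      ring
    refine (integral_congr_ae (Eventually.of_forall e2)).trans ?_
    rw [integral_neg, boundary_ibp (cut_contDiff _ k) (cut_hcs _ k) hG, neg_neg]
    congr 1
    ext y
    simp only [cut_pd]
    rw [EuclideanSpace.real_norm_sq_eq, Finset.mul_sum]
    congr 2
    exact Finset.sum_congr rfl fun i _ => by ring
  have ev : ∀ t : ℝ, ∀ᶠ k : ℕ in atTop, t < (k:ℝ) + 1 := by
    intro t
    obtain ⟨m, hm⟩ := exists_nat_gt t
    filter_upwards [eventually_ge_atTop m] with k hk
    have : (m:ℝ) ≤ k := by exact_mod_cast hk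
    linarith
  have cc : ∀ k, Continuous (cutc k) := by
    intro k
    unfold cutc
    exact (continuous_const.mul ((chi_contDiff.continuous_deriv (by norm_num)).comp
      (continuous_const.mul (continuous_pow 2)))).mul continuous_const
  have lim1 : Tendsto (fun k : ℕ => ∫ x in H, (cut (n+1) k x * D x + cutc k ‖x‖ * Q x)) atTop
      (𝓝 (∫ x in H, D x)) := by
    refine tendsto_integral_of_dominated_convergence
      (fun x => |D x| + K * (3/2 * (ρ (x l) * g x) + |F x|)) ?_ ?_ ?_ ?_
    · intro k
      have hQc : Continuous Q := continuous_finsetSum _ fun i _ =>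
        (coord_contDiff i (k := 1)).continuous.mul (hV i).continuous
      exact ((cut_contDiff _ k).continuous.aestronglyMeasurable.mul hDi.aestronglyMeasurable).add
        (((cc k).comp continuous_norm).mul hQc).aestronglyMeasurable
    · exact hDi.abs.add (((he.const_mul (3/2)).add hFi.abs).const_mul K)
    · intro k
      filter_upwards [ae_restrict_mem hHm] with x hx
      have h1 : |cut (n+1) k x * D x| ≤ |D x| := by
        rw [abs_mul, abs_of_nonneg (cut_nonneg _ _ _)]
        exact mul_le_of_le_one_left (abs_nonneg _) (cut_le_one _ _ _)
      have hg : 0 ≤ g x := Finset.sum_nonneg fun j _ => mul_self_nonneg _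
      have hr := hρpos _ hx
      have h2 : |cutc k ‖x‖ * Q x| ≤ K * (3/2 * (ρ (x l) * g x) + |F x|) := by
        rw [abs_mul]
        calc _ ≤ |cutc k ‖x‖| * (‖x‖^2 * (3/2 * (ρ (x l) * g x) + |F x|)) :=
              mul_le_mul_of_nonneg_left (hQb x hx) (abs_nonneg _)
          _ = (|cutc k ‖x‖| * ‖x‖^2) * (3/2 * (ρ (x l) * g x) + |F x|) := by ring
          _ ≤ _ := mul_le_mul_of_nonneg_right (hK k _) (by positivity)
      exact (abs_add_le _ _).trans (add_le_add h1 h2)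
    · refine Eventually.of_forall fun x => ?_
      refine tendsto_const_nhds.congr' ?_
      filter_upwards [ev ‖x‖] with k hk
      rw [cut_one hk, cutc_zero (norm_nonneg _) hk]; ring
  have hGi : Integrable G := hLq.const_mul _
  have lim2 : Tendsto (fun k : ℕ => ∫ y : EuclideanSpace ℝ (Fin n), (n * cut n k y + cutc k ‖y‖ * ‖y‖^2) * G y) atTop
      (𝓝 (∫ y, n * G y)) := by
    refine tendsto_integral_of_dominated_convergence (fun y => (n + K) * |G y|) ?_ ?_ ?_ ?_
    · intro k
      exact (((continuous_const.mul (cut_contDiff n k).continuous).add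
        (((cc k).comp continuous_norm).mul (continuous_norm.pow 2))).mul hG.continuous).aestronglyMeasurable
    · exact hGi.abs.const_mul _
    · intro k
      refine Eventually.of_forall fun y => ?_
      rw [Real.norm_eq_abs, abs_mul]
      refine mul_le_mul_of_nonneg_right ?_ (abs_nonneg _)
      refine (abs_add_le _ _).trans (add_le_add ?_ ?_)
      · rw [abs_of_nonneg (mul_nonneg (Nat.cast_nonneg n) (cut_nonneg _ _ _))]
        exact mul_le_of_le_one_right (Nat.cast_nonneg n) (cut_le_one _ _ _)
      · rw [abs_mul, abs_of_nonneg (sq_nonneg ‖y‖)]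
        exact hK k _
    · refine Eventually.of_forall fun x => ?_
      refine tendsto_const_nhds.congr' ?_
      filter_upwards [ev ‖x‖] with k hk
      rw [cut_one hk, cutc_zero (norm_nonneg _) hk]; ring
  have fin := tendsto_nhds_unique lim1 ((lim2.neg).congr fun k => (main k).symm)
  have s1 : ∫ x in H, D x = (1 - ((n+1 : ℕ):ℝ)/2) * (∫ x in H, ρ (x l) * g x)
      - (1/2) * (∫ x in H, deriv ρ (x l) * x l * g x) + ((n+1 : ℕ):ℝ) * (∫ x in H, F x) := by
    have i1 : IntegrableOn (fun x => (1 - ((n+1 : ℕ):ℝ)/2) * (ρ (x l) * g x)) H := he.const_mul _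
    have i2 : IntegrableOn (fun x => (1/2) * (deriv ρ (x l) * x l * g x)) H := he'.const_mul _
    have i12 : IntegrableOn (fun x => (1 - ((n+1 : ℕ):ℝ)/2) * (ρ (x l) * g x)
      - (1/2) * (deriv ρ (x l) * x l * g x)) H := i1.sub i2
    simp only [D]
    rw [integral_add i12 (hFi.const_mul _), integral_sub i1 i2, integral_const_mul, integral_const_mul,
      integral_const_mul]
  have s2 : ∫ x in H, F x = a / p * ∫ x in H, |u x| ^ p := integral_const_mul _ _
  have s3 : ∫ y, n * G y = n * (b / q * ∫ y : EuclideanSpace ℝ (Fin n), |u (bPt (n+1) y)| ^ q) := by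
    rw [integral_const_mul, integral_const_mul]
  rw [s1, s2, s3] at fin
  exact fin

lemma norm_grad_sq {N : ℕ} {u : EuclideanSpace ℝ (Fin N) → ℝ} (x) :
    ‖gradient u x‖ ^ 2 = ∑ j, pd N u j x * pd N u j x := by
  rw [EuclideanSpace.real_norm_sq_eq]
  refine Finset.sum_congr rfl fun j _ => ?_
  have : gradient u x j = pd N u j x := by
    unfold pd gradient
    rw [← InnerProductSpace.toDual_symm_apply (𝕜 := ℝ), EuclideanSpace.inner_single_right]
    simp
  rw [this, sq]

lemma rigidity {n : ℕ} {ρ : ℝ → ℝ} (hρ : ContDiff ℝ 1 ρ)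
    (hρ1 : ∀ s : ℝ, 0 < s → 0 < deriv ρ s * s) {b q : ℝ} (hb : 0 < b)
    {u : EuclideanSpace ℝ (Fin (n+1)) → ℝ} (hu : ContDiff ℝ 2 u)
    (hbd : ∀ y : EuclideanSpace ℝ (Fin n), -pd (n+1) u (Fin.last n) (bPt (n+1) y)
      = b * |u (bPt (n+1) y)| ^ (q-2) * u (bPt (n+1) y))
    (he' : IntegrableOn (fun x => deriv ρ (x (Fin.last n)) * x (Fin.last n) *
        ∑ j, pd (n+1) u j x * pd (n+1) u j x)
      {x : EuclideanSpace ℝ (Fin (n+1)) | 0 < x (Fin.last n)})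
    (h0 : (∫ x in {x : EuclideanSpace ℝ (Fin (n+1)) | 0 < x (Fin.last n)},
        deriv ρ (x (Fin.last n)) * x (Fin.last n) * ∑ j, pd (n+1) u j x * pd (n+1) u j x) ≤ 0) :
    ∀ x : EuclideanSpace ℝ (Fin (n+1)), 0 ≤ x (Fin.last n) → u x = 0 := by
  set l := Fin.last n
  have hcl : Continuous (fun x : EuclideanSpace ℝ (Fin (n+1)) => x l) :=
    (coord_contDiff l (k := 1)).continuous
  have hHo : IsOpen {x : EuclideanSpace ℝ (Fin (n+1)) | 0 < x l} := isOpen_lt continuous_const hcl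
  have hU : ∀ j, Continuous (pd (n+1) u j) := fun j => pd_contDiff (hu.of_le (by norm_num))
  have hnn : 0 ≤ᵐ[volume.restrict {x : EuclideanSpace ℝ (Fin (n+1)) | 0 < x l}] (fun x =>
      deriv ρ (x l) * x l * ∑ j, pd (n+1) u j x * pd (n+1) u j x) := by
    filter_upwards [ae_restrict_mem hHo.measurableSet] with x hx
    exact mul_nonneg (hρ1 _ hx).le (Finset.sum_nonneg fun j _ => mul_self_nonneg _)
  have hz := (integral_eq_zero_iff_of_nonneg_ae hnn he').1 (le_antisymm h0 (integral_nonneg_of_ae hnn))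
  have hz2 := Measure.eqOn_open_of_ae_eq hz hHo
    ((((hρ.continuous_deriv le_rfl).comp hcl).mul hcl).mul
      (continuous_finsetSum _ fun j _ => (hU j).mul (hU j))).continuousOn continuousOn_const
  have hg : ∀ x : EuclideanSpace ℝ (Fin (n+1)), 0 < x l → ∀ j, pd (n+1) u j x = 0 := by
    intro x hx j
    have h1 := hz2 hx
    simp only [Pi.zero_apply] at h1
    have h2 := (mul_eq_zero.1 h1).resolve_left (hρ1 _ hx).ne'
    have h3 := (Finset.sum_eq_zero_iff_of_nonneg (fun j _ => mul_self_nonneg (pd (n+1) u j x))).1 h2 j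
      (Finset.mem_univ j)
    exact mul_self_eq_zero.1 h3
  have hg2 : ∀ x : EuclideanSpace ℝ (Fin (n+1)), 0 ≤ x l → ∀ j, pd (n+1) u j x = 0 := by
    intro x hx j
    have hc : Continuous (fun t : ℝ => pd (n+1) u j (x + t • EuclideanSpace.single l (1:ℝ))) :=
      (hU j).comp (continuous_const.add (continuous_id.smul continuous_const))
    have h1 : Tendsto (fun t : ℝ => pd (n+1) u j (x + t • EuclideanSpace.single l (1:ℝ))) (𝓝[>] 0)
        (𝓝 (pd (n+1) u j x)) := by
      have := (hc.tendsto 0).mono_left (nhdsWithin_le_nhds (s := Set.Ioi 0))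
      simpa using this
    refine tendsto_nhds_unique h1 (tendsto_const_nhds.congr' ?_)
    filter_upwards [self_mem_nhdsWithin] with t ht
    refine (hg _ ?_ j).symm
    have ht : 0 < t := ht
    simp
    linarith
  have hfd : ∀ x : EuclideanSpace ℝ (Fin (n+1)), 0 ≤ x l → fderiv ℝ u x = 0 := by
    intro x hx
    have h := (EuclideanSpace.basisFun (Fin (n+1)) ℝ).toBasis.ext (f₁ := (fderiv ℝ u x : _ →ₗ[ℝ] ℝ)) (f₂ := 0)
      (fun j => by simpa [pd] using hg2 x hx j)
    ext v
    exact congrArg (fun f => f v) h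
  have hconv : Convex ℝ {x : EuclideanSpace ℝ (Fin (n+1)) | 0 ≤ x l} := by
    intro x hx y hy s t hs ht _
    have hx : 0 ≤ x l := hx
    have hy : 0 ≤ y l := hy
    change 0 ≤ (s • x + t • y) l
    simp only [PiLp.add_apply, PiLp.smul_apply, smul_eq_mul]
    positivity
  have hconst : ∀ x y : EuclideanSpace ℝ (Fin (n+1)), 0 ≤ x l → 0 ≤ y l → u x = u y := by
    intro x y hx hy
    have := hconv.norm_image_sub_le_of_norm_fderiv_le (𝕜 := ℝ) (f := u) (C := 0)
      (fun x _ => hu.differentiable two_ne_zero x) (fun x hx => by rw [hfd x hx]; simp) hx hy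
    simp only [zero_mul, norm_le_zero_iff, sub_eq_zero] at this
    exact this.symm
  intro x hx
  have hb0 : bPt (n+1) (0 : EuclideanSpace ℝ (Fin n)) l = 0 := bPt_last n 0
  rw [hconst x (bPt (n+1) (0 : EuclideanSpace ℝ (Fin n))) hx hb0.ge]
  have h1 := hbd 0
  rw [hg2 _ hb0.ge, neg_zero] at h1
  by_contra hne
  have : 0 < |u (bPt (n+1) (0 : EuclideanSpace ℝ (Fin n)))| ^ (q-2) :=
    Real.rpow_pos_of_pos (abs_pos.2 hne) _
  have := mul_ne_zero (mul_ne_zero hb.ne' this.ne') hne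
  exact this h1.symm

theorem stmt12 (N : ℕ) (hN : 3 ≤ N) (ρ : ℝ → ℝ) (hρC1 : ContDiff ℝ 1 ρ)
    (hρzero : ρ 0 = 1) (γ : ℝ) (hγ : 0 < γ)
    (hρlow : ∀ s : ℝ, 0 ≤ s → (1 + s) ^ γ ≤ ρ s)
    (c₁ : ℝ) (hc₁ : 0 < c₁)
    (hρ1 : ∀ s : ℝ, 0 < s → 0 < deriv ρ s * s ∧ deriv ρ s * s ≤ c₁ * ρ s)
    (a b p : ℝ) (ha : a ≤ 0) (hb : 0 < b) (hp1 : 1 < p)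
    (hp2 : p ≤ 2 * (N : ℝ) / ((N : ℝ) - 2))
    (u : EuclideanSpace ℝ (Fin N) → ℝ) (hu : ContDiff ℝ 2 u)
    (hsol : IsSolutionP0 N (by omega) ρ a b p (2 * ((N : ℝ) - 1) / ((N : ℝ) - 2)) u)
    (hpos : ∀ x, 0 ≤ xN N (by omega) x → 0 ≤ u x)
    (henergy : IntegrableOn (fun x => ρ (xN N (by omega) x) * ‖gradient u x‖ ^ 2)
      (Hplus N (by omega)) volume)
    (hLp : IntegrableOn (fun x => |u x| ^ p) (Hplus N (by omega)) volume)
    (hLq : Integrable (fun y : EuclideanSpace ℝ (Fin (N - 1)) =>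
      |u (bPt N y)| ^ (2 * ((N : ℝ) - 1) / ((N : ℝ) - 2))))
    (hident : (∫ x in Hplus N (by omega),
        ρ (xN N (by omega) x) * ‖gradient u x‖ ^ 2) =
      a * (∫ x in Hplus N (by omega), u x ^ p) +
        b * ∫ y : EuclideanSpace ℝ (Fin (N - 1)),
          u (bPt N y) ^ (2 * ((N : ℝ) - 1) / ((N : ℝ) - 2))) :
    ∀ x, 0 ≤ xN N (by omega) x → u x = 0 := by
  obtain ⟨n, rfl⟩ : ∃ n, N = n + 1 := ⟨N - 1, by omega⟩
  have hn : (2:ℝ) ≤ n := by exact_mod_cast (by omega : 2 ≤ n)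
  obtain ⟨heq, hbd⟩ := hsol
  have hNc : ((n + 1 : ℕ) : ℝ) = (n:ℝ) + 1 := by push_cast; ring
  have hq : (1:ℝ) < 2 * (((n + 1 : ℕ) : ℝ) - 1) / (((n + 1 : ℕ) : ℝ) - 2) := by
    rw [hNc, lt_div_iff₀ (by linarith)]; linarith
  have hqv : (2 * (((n + 1 : ℕ) : ℝ) - 1) / (((n + 1 : ℕ) : ℝ) - 2)) * ((n:ℝ) - 1) = 2 * n := by
    rw [hNc]
    have : (n:ℝ) + 1 - 2 ≠ 0 := by linarith
    field_simp
    ring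
  have hpv : p * ((n:ℝ) - 1) ≤ 2 * (n + 1) := by
    rw [hNc, le_div_iff₀ (by linarith)] at hp2
    linarith
  generalize 2 * (((n + 1 : ℕ) : ℝ) - 1) / (((n + 1 : ℕ) : ℝ) - 2) = q at *
  have hρpos : ∀ s : ℝ, 0 < s → 0 ≤ ρ s := fun s hs =>
    (Real.rpow_nonneg (by linarith) γ).trans (hρlow s hs.le)
  have hHm : MeasurableSet {x : EuclideanSpace ℝ (Fin (n+1)) | 0 < x (Fin.last n)} :=
    (isOpen_lt continuous_const (coord_contDiff (Fin.last n) (k := 1)).continuous).measurableSet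
  simp only [norm_grad_sq] at henergy hident
  have hHeq : Hplus (n+1) (by omega) = {x : EuclideanSpace ℝ (Fin (n+1)) | 0 < x (Fin.last n)} := rfl
  have hx : ∀ x, xN (n+1) (by omega) x = x (Fin.last n) := fun x => rfl
  simp only [hHeq, hx] at henergy hident hLp hpos ⊢
  have heq' : ∀ x : EuclideanSpace ℝ (Fin (n+1)), 0 < x (Fin.last n) →
      ∑ i, pd (n+1) (fun z => ρ (z (Fin.last n)) * pd (n+1) u i z) i x = -(a * |u x| ^ (p-2) * u x) := by
    intro x hx
    have h := heq x hx
    rw [← h, neg_neg]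
    rfl
  have hbd' : ∀ y : EuclideanSpace ℝ (Fin n), -pd (n+1) u (Fin.last n) (bPt (n+1) y)
      = b * |u (bPt (n+1) y)| ^ (q-2) * u (bPt (n+1) y) := hbd
  have hLq' : Integrable (fun y : EuclideanSpace ℝ (Fin n) => |u (bPt (n+1) y)| ^ q) := hLq
  have hcl : Continuous (fun x : EuclideanSpace ℝ (Fin (n+1)) => x (Fin.last n)) :=
    (coord_contDiff (Fin.last n) (k := 1)).continuous
  have hU : ∀ j, Continuous (pd (n+1) u j) := fun j => pd_contDiff (hu.of_le (by norm_num))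
  have he' : IntegrableOn (fun x => deriv ρ (x (Fin.last n)) * x (Fin.last n) *
        ∑ j, pd (n+1) u j x * pd (n+1) u j x)
      {x : EuclideanSpace ℝ (Fin (n+1)) | 0 < x (Fin.last n)} := by
    refine Integrable.mono' (henergy.const_mul c₁)
      ((((hρC1.continuous_deriv le_rfl).comp hcl).mul hcl).mul
      (continuous_finsetSum _ fun j _ => (hU j).mul (hU j))).aestronglyMeasurable ?_
    filter_upwards [ae_restrict_mem hHm] with x hx
    have hg : 0 ≤ ∑ j, pd (n+1) u j x * pd (n+1) u j x := Finset.sum_nonneg fun j _ => mul_self_nonneg _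
    have h1 := hρ1 _ hx
    rw [Real.norm_of_nonneg (mul_nonneg h1.1.le hg), ← mul_assoc]
    exact mul_le_mul_of_nonneg_right h1.2 hg
  have poh := pohozaev hρC1 hρzero hρpos hp1 hq hu heq' hbd' henergy he' hLp hLq'
  refine rigidity hρC1 (fun s hs => (hρ1 s hs).1) hb hu hbd' he' ?_
  have i1 : ∫ x in {x : EuclideanSpace ℝ (Fin (n+1)) | 0 < x (Fin.last n)}, u x ^ p
      = ∫ x in {x : EuclideanSpace ℝ (Fin (n+1)) | 0 < x (Fin.last n)}, |u x| ^ p := by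
    refine setIntegral_congr_fun hHm fun x hx => ?_
    have : 0 < x (Fin.last n) := hx
    simp only [abs_of_nonneg (hpos x this.le)]
  have i2 : ∫ y : EuclideanSpace ℝ (Fin (n + 1 - 1)), u (bPt (n+1) y) ^ q
      = ∫ y : EuclideanSpace ℝ (Fin n), |u (bPt (n+1) y)| ^ q := by
    refine integral_congr_ae (Eventually.of_forall fun y => ?_)
    have : 0 ≤ u (bPt (n+1) y) := hpos _ (bPt_last n y).ge
    simp only [abs_of_nonneg this]
  rw [i1, i2] at hident
  rw [hident] at poh
  have hA : 0 ≤ ∫ x in {x : EuclideanSpace ℝ (Fin (n+1)) | 0 < x (Fin.last n)}, |u x| ^ p :=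
    integral_nonneg fun x => Real.rpow_nonneg (abs_nonneg _) _
  generalize (∫ x in {x : EuclideanSpace ℝ (Fin (n+1)) | 0 < x (Fin.last n)}, |u x| ^ p) = A at *
  generalize (∫ y : EuclideanSpace ℝ (Fin n), |u (bPt (n+1) y)| ^ q) = B at *
  generalize (∫ x in {x : EuclideanSpace ℝ (Fin (n+1)) | 0 < x (Fin.last n)},
        deriv ρ (x (Fin.last n)) * x (Fin.last n) * ∑ j, pd (n+1) u j x * pd (n+1) u j x) = C at *
  rw [hNc] at poh
  have hB : n * (b / q * B) = ((n:ℝ) - 1) / 2 * (b * B) := by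
    have hq0 : q ≠ 0 := by linarith
    field_simp
    linear_combination (-B) * hqv
  have hAA : ((n:ℝ) + 1) * (a / p * A) - ((n:ℝ) - 1) / 2 * (a * A) ≤ 0 := by
    have hp0 : 0 < p := by linarith
    have e : ((n:ℝ) + 1) * (a / p * A) - ((n:ℝ) - 1) / 2 * (a * A)
      = (a * A) * ((2 * (n+1) - p * (n - 1)) / (2 * p)) := by
      field_simp
    rw [e]
    exact mul_nonpos_of_nonpos_of_nonneg (mul_nonpos_of_nonpos_of_nonneg ha hA)
      (div_nonneg (by linarith) (by linarith))
  rw [hB] at poh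
  nlinarith
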